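/- (Main theorem) Let φ₁, φ₂, φ₃, φ₄ be complex numbers, φ = [[φ₁, −φ₂*, φ₃, φ₄*],[φ₂, φ₁*, φ₄, −φ₃*],[φ₃, φ₄*, φ₁, −φ₂*],[φ₄, −φ₃*, φ₂, φ₁*]] ∈ M₄(ℂ) a Dirac-Hestenes spinor matrix, e₄₁ = ½(1+Γ₀)·½(1+iΓ₁Γ₂), and Φ = φ·e₄₁ the corresponding Dirac spinor, which equals the matrix whose first column is (φ₁, φ₂, φ₃, φ₄)ᵀ and all other entries zero (an element of the minimal left ideal M₄(ℂ)·e₄₁). Then with K = (Γ₁Γ₃)·(Γ₀Γ₁Γ₂Γ₃)ᵀ, the charge-conjugated spinor Φ̃* = K Φᵀ K⁻¹ equals the matrix whose last row is (−φ₄, φ₃, −φ₂, φ₁) and all other entries zero; equivalently Φ̃* = ẽ₄₁*·φ̃* where ẽ₄₁* = K e₄₁ᵀ K⁻¹ = diag(0,0,0,1) and φ̃* = K φᵀ K⁻¹. In particular Φ̃* belongs to the minimal right ideal diag(0,0,0,1)·M₄(ℂ): under the antiautomorphism A → Ã* the Dirac spinor, a minimal left ideal element, is transferred into a minimal right ideal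 element. -/

import Mathlib

open Matrix

/-- The spinbasis gamma matrices in `M₄(ℂ)`. -/
def Γ0 : Matrix (Fin 4) (Fin 4) ℂ :=
  !![1, 0, 0, 0; 0, 1, 0, 0; 0, 0, -1, 0; 0, 0, 0, -1]

def Γ1 : Matrix (Fin 4) (Fin 4) ℂ :=
  !![0, 0, 0, 1; 0, 0, 1, 0; 0, -1, 0, 0; -1, 0, 0, 0]

def Γ2 : Matrix (Fin 4) (Fin 4) ℂ :=
  !![0, 0, 0, -Complex.I; 0, 0, Complex.I, 0; 0, Complex.I, 0, 0; -Complex.I, 0, 0, 0]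

def Γ3 : Matrix (Fin 4) (Fin 4) ℂ :=
  !![0, 0, 1, 0; 0, 0, 0, -1; -1, 0, 0, 0; 0, 1, 0, 0]

/-- The primitive idempotent `e₄₁ = ½(1 + Γ₀)·½(1 + iΓ₁Γ₂)` of the Dirac algebra
`ℂ₄ ≅ M₄(ℂ)`. -/
noncomputable def e41 : Matrix (Fin 4) (Fin 4) ℂ :=
  (((1 : ℂ) / 2) • ((1 : Matrix (Fin 4) (Fin 4) ℂ) + Γ0)) *
    (((1 : ℂ) / 2) • ((1 : Matrix (Fin 4) (Fin 4) ℂ) + Complex.I • (Γ1 * Γ2)))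

/-- The matrix `K = (Γ₁Γ₃)·(Γ₀Γ₁Γ₂Γ₃)ᵀ` of the charge conjugation `A → Ã*`. -/
noncomputable def K : Matrix (Fin 4) (Fin 4) ℂ := (Γ1 * Γ3) * (Γ0 * Γ1 * Γ2 * Γ3)ᵀ

/-- The Dirac-Hestenes spinor matrix built from `φ₁, φ₂, φ₃, φ₄ ∈ ℂ`. -/
noncomputable def DH (φ₁ φ₂ φ₃ φ₄ : ℂ) : Matrix (Fin 4) (Fin 4) ℂ :=
  !![φ₁, -star φ₂, φ₃, star φ₄;
     φ₂, star φ₁, φ₄, -star φ₃;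
     φ₃, star φ₄, φ₁, -star φ₂;
     φ₄, -star φ₃, φ₂, star φ₁]

theorem e41_eq : e41 = !![1, 0, 0, 0; 0, 0, 0, 0; 0, 0, 0, 0; 0, 0, 0, 0] := by
  ext i j
  fin_cases i <;> fin_cases j <;>
    simp [e41, Γ0, Γ1, Γ2, Matrix.mul_apply, Fin.sum_univ_four, Matrix.one_apply,
      ← two_mul]

theorem K_eq : K = !![0, 0, 0, -Complex.I; 0, 0, Complex.I, 0;
    0, -Complex.I, 0, 0; Complex.I, 0, 0, 0] := by
  ext i j
  fin_cases i <;> fin_cases j <;>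
    simp [K, Γ0, Γ1, Γ2, Γ3, Matrix.mul_apply, Fin.sum_univ_four]

theorem K_mul_self : K * K = 1 := by
  rw [K_eq]
  ext i j
  fin_cases i <;> fin_cases j <;> simp [Matrix.mul_apply, Fin.sum_univ_four]

theorem K_inv : K⁻¹ = K := Matrix.inv_eq_left_inv K_mul_self

theorem DH_mul_e41 (φ₁ φ₂ φ₃ φ₄ : ℂ) :
    DH φ₁ φ₂ φ₃ φ₄ * e41
      = !![φ₁, 0, 0, 0; φ₂, 0, 0, 0; φ₃, 0, 0, 0; φ₄, 0, 0, 0] := by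
  rw [e41_eq]
  ext i j
  fin_cases i <;> fin_cases j <;> simp [DH, Matrix.mul_apply, Fin.sum_univ_four]

/-- Charge conjugation sends a matrix supported in its first column to one supported in its
last row. -/
theorem K_mul_transpose_mul_K (a b c d : ℂ) :
    K * (!![a, 0, 0, 0; b, 0, 0, 0; c, 0, 0, 0; d, 0, 0, 0])ᵀ * K
      = !![0, 0, 0, 0; 0, 0, 0, 0; 0, 0, 0, 0; -d, c, -b, a] := by
  have h (z : ℂ) : Complex.I * z * Complex.I = -z := by
    rw [mul_right_comm, Complex.I_mul_I, neg_one_mul]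
  rw [K_eq]
  ext i j
  fin_cases i <;> fin_cases j <;>
    simp [Matrix.mul_apply, Fin.sum_univ_four, Matrix.vecMul, dotProduct, h]

/-- The map `A ↦ KAᵀK` reverses products. -/
theorem K_mul_transpose_mul (A B : Matrix (Fin 4) (Fin 4) ℂ) :
    K * (A * B)ᵀ * K = (K * Bᵀ * K) * (K * Aᵀ * K) :=
  calc K * (A * B)ᵀ * K = K * Bᵀ * 1 * Aᵀ * K := by
        simp only [Matrix.transpose_mul, Matrix.mul_one, Matrix.mul_assoc]
    _ = (K * Bᵀ * K) * (K * Aᵀ * K) := by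
        rw [← K_mul_self]; simp only [Matrix.mul_assoc]

/-- **Main theorem.** The Dirac spinor `Φ = φ·e₄₁`, a minimal left
ideal element whose only nonzero entries form the first column `(φ₁, φ₂, φ₃, φ₄)ᵀ`,
is transferred by the charge conjugation `A → Ã* = KAᵀK⁻¹` into the minimal right
ideal element whose only nonzero entries form the last row `(−φ₄, φ₃, −φ₂, φ₁)`;
moreover `Φ̃* = ẽ₄₁*·φ̃*` with `ẽ₄₁* = Ke₄₁ᵀK⁻¹ = diag(0,0,0,1)`, and `Φ̃*` lies in
the right ideal `diag(0,0,0,1)·M₄(ℂ)`. -/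
theorem dirac_spinor_charge_conjugation (φ₁ φ₂ φ₃ φ₄ : ℂ) :
    DH φ₁ φ₂ φ₃ φ₄ * e41
      = !![φ₁, 0, 0, 0; φ₂, 0, 0, 0; φ₃, 0, 0, 0; φ₄, 0, 0, 0] ∧
    K * (DH φ₁ φ₂ φ₃ φ₄ * e41)ᵀ * K⁻¹
      = !![0, 0, 0, 0; 0, 0, 0, 0; 0, 0, 0, 0; -φ₄, φ₃, -φ₂, φ₁] ∧
    K * e41ᵀ * K⁻¹ = !![0, 0, 0, 0; 0, 0, 0, 0; 0, 0, 0, 0; 0, 0, 0, 1] ∧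
    K * (DH φ₁ φ₂ φ₃ φ₄ * e41)ᵀ * K⁻¹
      = (K * e41ᵀ * K⁻¹) * (K * (DH φ₁ φ₂ φ₃ φ₄)ᵀ * K⁻¹) ∧
    ∃ A : Matrix (Fin 4) (Fin 4) ℂ,
      K * (DH φ₁ φ₂ φ₃ φ₄ * e41)ᵀ * K⁻¹
        = !![0, 0, 0, 0; 0, 0, 0, 0; 0, 0, 0, 0; 0, 0, 0, 1] * A := by
  have h_idem : K * e41ᵀ * K = !![0, 0, 0, 0; 0, 0, 0, 0; 0, 0, 0, 0; 0, 0, 0, 1] := by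
    rw [e41_eq, K_mul_transpose_mul_K]
    simp
  rw [K_inv]
  refine ⟨DH_mul_e41 φ₁ φ₂ φ₃ φ₄, ?_, h_idem, K_mul_transpose_mul _ _,
    K * (DH φ₁ φ₂ φ₃ φ₄)ᵀ * K, ?_⟩
  · rw [DH_mul_e41, K_mul_transpose_mul_K]
  · rw [K_mul_transpose_mul, h_idem]
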